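/- Fix L > 0 and a continuous function W : [0,L] → ℝ with sup norm ‖W‖. Then each S_k is twice differentiable on (0,∞), and there exists a constant C depending only on L such that for every integer k ≥ 1 and every λ ≥ 1: |S_k'(λ)| ≤ C (k+1) ‖W‖^k L^k / (k! · λ^{(k+2)/2}) and |S_k''(λ)| ≤ C (k+1)² ‖W‖^k L^k / (k! · λ^{(k+3)/2}). -/

import Mathlib

open MeasureTheory Real Set

/-- The simplex `Δ_k = {0 ≤ t₁ ≤ ⋯ ≤ t_k ≤ L}` in `ℝ^k`. -/
def simplexSet (L : ℝ) (k : ℕ) : Set (Fin k → ℝ) :=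
  {t | Monotone t ∧ ∀ i, t i ∈ Set.Icc (0:ℝ) L}

/-- The extended sequence `(0, t₁, …, t_k, L)` of length `k+2`. -/
def extSeq (L : ℝ) {k : ℕ} (t : Fin k → ℝ) : Fin (k+2) → ℝ :=
  Fin.snoc (Fin.cons 0 t) L

/-- `S_k(λ) = ∫_{Δ_k} λ^{−(k+1)/2} ∏_{j=0}^{k} sin(√λ(t_{j+1}−t_j)) ∏_{j=1}^{k} W(t_j) dt`. -/
noncomputable def Sfun (L : ℝ) (W : ℝ → ℝ) (k : ℕ) (lam : ℝ) : ℝ :=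
  ∫ t in simplexSet L k,
    lam ^ (-((k:ℝ)+1)/2) *
      (∏ j : Fin (k+1),
        Real.sin (Real.sqrt lam * (extSeq L t j.succ - extSeq L t j.castSucc))) *
      ∏ j : Fin k, W (t j)

lemma isClosed_simplexSet (L : ℝ) (k : ℕ) : IsClosed (simplexSet L k) := by
  have : simplexSet L k = {t | Monotone t} ∩ Set.univ.pi fun _ => Icc 0 L := by
    ext t; simp only [simplexSet, mem_ofPred_eq, mem_inter_iff, mem_univ_pi]
  rw [this]
  exact isClosed_monotone.inter (isClosed_set_pi fun _ _ => isClosed_Icc)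

lemma isCompact_simplexSet (L : ℝ) (k : ℕ) : IsCompact (simplexSet L k) :=
  (isCompact_univ_pi fun _ : Fin k => isCompact_Icc (a := (0:ℝ)) (b := L)).of_isClosed_subset
    (isClosed_simplexSet L k) fun _ ht i _ => ht.2 i

lemma isClosed_setOf_mem_simplexSet (L : ℝ) (k : ℕ) :
    IsClosed {p : ℝ × (Fin k → ℝ) | p.1 ∈ Icc 0 L ∧ p.2 ∈ simplexSet p.1 k} := by
  have h : {p : ℝ × (Fin k → ℝ) | p.1 ∈ Icc 0 L ∧ p.2 ∈ simplexSet p.1 k} =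
      Prod.fst ⁻¹' Icc 0 L ∩ (Prod.snd ⁻¹' {t | Monotone t} ∩
        ⋂ i, {p : ℝ × (Fin k → ℝ) | 0 ≤ p.2 i} ∩ {p | p.2 i ≤ p.1}) := by
    ext p; simp [simplexSet]
  rw [h]
  refine (isClosed_Icc.preimage continuous_fst).inter
    ((isClosed_monotone.preimage continuous_snd).inter (isClosed_iInter fun i => ?_))
  exact (isClosed_le (by fun_prop) (by fun_prop)).inter (isClosed_le (by fun_prop) (by fun_prop))

lemma volume_simplexSet_le (k : ℕ) :
    ∀ L : ℝ, 0 ≤ L → volume (simplexSet L k) ≤ ENNReal.ofReal (L ^ k / k.factorial) := by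
  induction k with
  | zero =>
    intro L _
    refine (measure_mono (subset_univ _)).trans ?_
    simp [volume_pi]
  | succ k ih =>
    intro L hL
    set A := {p : ℝ × (Fin k → ℝ) | p.1 ∈ Icc 0 L ∧ p.2 ∈ simplexSet p.1 k} with hA
    have hAm : MeasurableSet A := (isClosed_setOf_mem_simplexSet L k).measurableSet
    have hmp := volume_preserving_piFinSuccAbove (fun _ : Fin (k + 1) => ℝ) (Fin.last k)
    have hsub : simplexSet L (k + 1) ⊆
        MeasurableEquiv.piFinSuccAbove (fun _ : Fin (k + 1) => ℝ) (Fin.last k) ⁻¹' A := by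
      intro t ht
      refine ⟨ht.2 _, fun i j hij => ?_, fun i => ⟨(ht.2 _).1, ht.1 (Fin.le_last _)⟩⟩
      exact ht.1 ((Fin.strictMono_succAbove _).monotone hij)
    calc volume (simplexSet L (k + 1))
        ≤ volume A := by
          rw [← hmp.measure_preimage hAm.nullMeasurableSet]
          exact measure_mono hsub
      _ = ∫⁻ x, volume (Prod.mk x ⁻¹' A) := by
          rw [Measure.volume_eq_prod, Measure.prod_apply hAm]
      _ ≤ ∫⁻ x, (Icc 0 L).indicator (fun x => ENNReal.ofReal (x ^ k / k.factorial)) x := by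
          refine lintegral_mono fun x => ?_
          by_cases hx : x ∈ Icc 0 L
          · rw [indicator_of_mem hx]
            exact (measure_mono fun s hs => hs.2).trans (ih x hx.1)
          · have : Prod.mk x ⁻¹' A = ∅ := by
              exact eq_empty_of_forall_notMem fun s hs => hx hs.1
            simp [this]
      _ = ∫⁻ x in Icc 0 L, ENNReal.ofReal (x ^ k / k.factorial) :=
          lintegral_indicator measurableSet_Icc _
      _ = ENNReal.ofReal (∫ x in Icc 0 L, x ^ k / k.factorial) := by
          rw [ofReal_integral_eq_lintegral_ofReal]
          · exact Continuous.integrableOn_Icc (by fun_prop)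
          · filter_upwards [ae_restrict_mem measurableSet_Icc] with x hx
            have := hx.1
            simp only [Pi.zero_apply]
            positivity
      _ = ENNReal.ofReal (L ^ (k + 1) / (k + 1).factorial) := by
          rw [integral_Icc_eq_integral_Ioc, ← intervalIntegral.integral_of_le hL,
            intervalIntegral.integral_div, integral_pow, Nat.factorial_succ]
          congr 1
          push_cast
          field_simp
          simp

lemma measureReal_simplexSet_le {L : ℝ} (hL : 0 ≤ L) (k : ℕ) :
    volume.real (simplexSet L k) ≤ L ^ k / k.factorial :=
  ENNReal.toReal_le_of_le_ofReal (by positivity) (volume_simplexSet_le k L hL)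

/-- The factor `sin (√x a) / √x`. -/
noncomputable def sincSqrt (x a : ℝ) : ℝ := sin (√x * a) / √x

/-- The first derivative of `sincSqrt` in its first variable. -/
noncomputable def sincSqrtDeriv (x a : ℝ) : ℝ :=
  a * cos (√x * a) / (2 * x) - sin (√x * a) / (2 * x * √x)

/-- The second derivative of `sincSqrt` in its first variable. -/
noncomputable def sincSqrtDeriv₂ (x a : ℝ) : ℝ :=
  -(a ^ 2 * sin (√x * a) / (4 * x * √x)) - 3 * a * cos (√x * a) / (4 * x ^ 2)
    + 3 * sin (√x * a) / (4 * x ^ 2 * √x)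

lemma hasDerivAt_sincSqrt {x : ℝ} (hx : 0 < x) (a : ℝ) :
    HasDerivAt (fun y => sincSqrt y a) (sincSqrtDeriv x a) x := by
  have hr : 0 < √x := Real.sqrt_pos.2 hx
  have hs := Real.hasDerivAt_sqrt hx.ne'
  refine ((hs.mul_const a).sin.div hs hr.ne').congr_deriv ?_
  have hx2 : x = √x ^ 2 := (Real.sq_sqrt hx.le).symm
  unfold sincSqrtDeriv
  generalize √x = r at *
  subst hx2
  field_simp

lemma hasDerivAt_sincSqrtDeriv {x : ℝ} (hx : 0 < x) (a : ℝ) :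
    HasDerivAt (fun y => sincSqrtDeriv y a) (sincSqrtDeriv₂ x a) x := by
  have hr : 0 < √x := Real.sqrt_pos.2 hx
  have hs := Real.hasDerivAt_sqrt hx.ne'
  have hid := (hasDerivAt_id x).const_mul 2
  refine ((((hs.mul_const a).cos.const_mul a).div hid (by simp [hx.ne'])).sub
    ((hs.mul_const a).sin.div (hid.mul hs) (by simp [hx.ne', hr.ne']))).congr_deriv ?_
  have hx2 : x = √x ^ 2 := (Real.sq_sqrt hx.le).symm
  unfold sincSqrtDeriv₂
  simp only [id, Pi.mul_apply]
  generalize √x = r at *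
  subst hx2
  field_simp
  ring

lemma continuous_sincSqrt (x : ℝ) : Continuous (sincSqrt x) := by
  unfold sincSqrt; fun_prop

lemma continuous_sincSqrtDeriv (x : ℝ) : Continuous (sincSqrtDeriv x) := by
  unfold sincSqrtDeriv; fun_prop

lemma continuous_sincSqrtDeriv₂ (x : ℝ) : Continuous (sincSqrtDeriv₂ x) := by
  unfold sincSqrtDeriv₂; fun_prop

lemma abs_sincSqrt_le (x a : ℝ) : |sincSqrt x a| ≤ (√x)⁻¹ := by
  rw [sincSqrt, abs_div, abs_of_nonneg (Real.sqrt_nonneg x), div_eq_mul_inv]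
  exact mul_le_of_le_one_left (by positivity) (abs_sin_le_one _)

lemma abs_sincSqrtDeriv_le {d x a L : ℝ} (hd : 0 < d) (hdx : d ≤ x) (ha : |a| ≤ L) :
    |sincSqrtDeriv x a| ≤ (L / 2 + 1 / (2 * √d)) * (√x)⁻¹ ^ 2 := by
  have hx : 0 < x := hd.trans_le hdx
  have hr : 0 < √x := Real.sqrt_pos.2 hx
  have hrd : 0 < √d := Real.sqrt_pos.2 hd
  have hdr : √d ≤ √x := Real.sqrt_le_sqrt hdx
  have hL : 0 ≤ L := (abs_nonneg a).trans ha
  have hx2 : x = √x ^ 2 := (Real.sq_sqrt hx.le).symm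
  have e : sincSqrtDeriv x a =
      (a * cos (√x * a) / 2 - sin (√x * a) * (1 / (2 * √x))) * (√x)⁻¹ ^ 2 := by
    unfold sincSqrtDeriv
    generalize √x = r at *
    subst hx2
    field_simp
  rw [e, abs_mul, abs_of_nonneg (by positivity : 0 ≤ (√x)⁻¹ ^ 2)]
  refine mul_le_mul_of_nonneg_right ((abs_sub _ _).trans (add_le_add ?_ ?_)) (by positivity)
  · rw [abs_div, abs_mul, abs_two]
    have := mul_le_mul ha (abs_cos_le_one (√x * a)) (abs_nonneg _) hL
    linarith
  · rw [abs_mul, abs_of_pos (by positivity : 0 < 1 / (2 * √x))]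
    refine (mul_le_of_le_one_left (by positivity) (abs_sin_le_one _)).trans ?_
    gcongr

lemma abs_sincSqrtDeriv₂_le {d x a L : ℝ} (hd : 0 < d) (hdx : d ≤ x) (ha : |a| ≤ L) :
    |sincSqrtDeriv₂ x a| ≤
      (L ^ 2 / 4 + 3 * L / 4 * (1 / √d) + 3 / 4 * (1 / √d) ^ 2) * (√x)⁻¹ ^ 3 := by
  have hx : 0 < x := hd.trans_le hdx
  have hr : 0 < √x := Real.sqrt_pos.2 hx
  have hrd : 0 < √d := Real.sqrt_pos.2 hd
  have hdr : √d ≤ √x := Real.sqrt_le_sqrt hdx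
  have hL : 0 ≤ L := (abs_nonneg a).trans ha
  have hx2 : x = √x ^ 2 := (Real.sq_sqrt hx.le).symm
  have e : sincSqrtDeriv₂ x a =
      (-(a ^ 2 / 4 * sin (√x * a)) - 3 * a / 4 * (1 / √x) * cos (√x * a)
        + 3 / 4 * (1 / √x) ^ 2 * sin (√x * a)) * (√x)⁻¹ ^ 3 := by
    unfold sincSqrtDeriv₂
    generalize √x = r at *
    subst hx2
    field_simp
  rw [e, abs_mul, abs_of_nonneg (by positivity : 0 ≤ (√x)⁻¹ ^ 3)]
  refine mul_le_mul_of_nonneg_right ((abs_add_le _ _).trans (add_le_add ((abs_sub _ _).trans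
    (add_le_add ?_ ?_)) ?_)) (by positivity)
  · rw [abs_neg, abs_mul, abs_of_nonneg (by positivity : 0 ≤ a ^ 2 / 4), ← sq_abs]
    refine (mul_le_of_le_one_right (by positivity) (abs_sin_le_one _)).trans ?_
    gcongr
  · rw [abs_mul]
    refine (mul_le_of_le_one_right (by positivity) (abs_cos_le_one _)).trans ?_
    rw [abs_mul, abs_div, abs_mul, abs_of_pos (by positivity : 0 < 1 / √x),
      abs_of_pos (by norm_num : (0:ℝ) < 3), abs_of_pos (by norm_num : (0:ℝ) < 4)]
    gcongr
  · rw [abs_mul, abs_of_nonneg (by positivity : 0 ≤ 3 / 4 * (1 / √x) ^ 2)]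
    refine (mul_le_of_le_one_right (by positivity) (abs_sin_le_one _)).trans ?_
    gcongr

lemma abs_prod_le_pow_card {ι : Type*} (s : Finset ι) {f : ι → ℝ} {A : ℝ} (h : ∀ i, |f i| ≤ A) :
    |∏ i ∈ s, f i| ≤ A ^ s.card := by
  rw [Finset.abs_prod, ← Finset.prod_const]
  exact Finset.prod_le_prod (fun _ _ => abs_nonneg _) fun i _ => h i

section ProductRule

variable {ι : Type*} [Fintype ι] [DecidableEq ι]

/-- The derivative of `∏ j, f j` when `f' j` is the derivative of `f j`. -/
def prodDeriv (f f' : ι → ℝ) : ℝ :=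
  ∑ i, (∏ j ∈ Finset.univ.erase i, f j) * f' i

/-- The second derivative of `∏ j, f j` when `f' j` and `f'' j` are the derivatives of `f j`. -/
def prodDeriv₂ (f f' f'' : ι → ℝ) : ℝ :=
  ∑ i, ((∑ l ∈ Finset.univ.erase i, (∏ j ∈ (Finset.univ.erase i).erase l, f j) * f' l) * f' i
    + (∏ j ∈ Finset.univ.erase i, f j) * f'' i)

lemma hasDerivAt_prod_prodDeriv {f f' : ℝ → ι → ℝ} {x : ℝ}
    (h : ∀ i, HasDerivAt (fun y => f y i) (f' x i) x) :
    HasDerivAt (fun y => ∏ i, f y i) (prodDeriv (f x) (f' x)) x :=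
  HasDerivAt.fun_finsetProd fun i _ => h i

lemma hasDerivAt_prodDeriv {f f' f'' : ℝ → ι → ℝ} {x : ℝ}
    (h : ∀ i, HasDerivAt (fun y => f y i) (f' x i) x)
    (h' : ∀ i, HasDerivAt (fun y => f' y i) (f'' x i) x) :
    HasDerivAt (fun y => prodDeriv (f y) (f' y)) (prodDeriv₂ (f x) (f' x) (f'' x)) x :=
  HasDerivAt.fun_sum fun i _ => (HasDerivAt.fun_finsetProd fun j _ => h j).mul (h' i)

lemma abs_prodDeriv_le {f f' : ι → ℝ} {A B : ℝ} (hA : 0 ≤ A)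
    (h : ∀ i, |f i| ≤ A) (h' : ∀ i, |f' i| ≤ B) :
    |prodDeriv f f'| ≤ Fintype.card ι * (A ^ (Fintype.card ι - 1) * B) := by
  refine (Finset.abs_sum_le_sum_abs _ _).trans ?_
  refine (Finset.sum_le_card_nsmul _ _ (A ^ (Fintype.card ι - 1) * B) fun i _ => ?_).trans
    (by simp)
  rw [abs_mul]
  refine mul_le_mul ((abs_prod_le_pow_card _ h).trans ?_) (h' i) (abs_nonneg _) (by positivity)
  simp

lemma abs_prodDeriv₂_le {f f' f'' : ι → ℝ} {A B D : ℝ} (hA : 0 ≤ A)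
    (h : ∀ i, |f i| ≤ A) (h' : ∀ i, |f' i| ≤ B) (h'' : ∀ i, |f'' i| ≤ D) :
    |prodDeriv₂ f f' f''| ≤ Fintype.card ι *
      (((Fintype.card ι - 1 : ℕ) * (A ^ (Fintype.card ι - 1 - 1) * B)) * B
        + A ^ (Fintype.card ι - 1) * D) := by
  refine (Finset.abs_sum_le_sum_abs _ _).trans ?_
  refine (Finset.sum_le_card_nsmul _ _ (((Fintype.card ι - 1 : ℕ) *
    (A ^ (Fintype.card ι - 1 - 1) * B)) * B + A ^ (Fintype.card ι - 1) * D) fun i _ => ?_).trans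
    (by simp [mul_add])
  have hB : 0 ≤ B := (abs_nonneg _).trans (h' i)
  refine (abs_add_le _ _).trans (add_le_add ?_ ?_)
  · rw [abs_mul]
    refine mul_le_mul ?_ (h' i) (abs_nonneg _) (by positivity)
    refine (Finset.abs_sum_le_sum_abs _ _).trans ?_
    refine (Finset.sum_le_card_nsmul _ _ (A ^ (Fintype.card ι - 1 - 1) * B) fun l hl => ?_).trans
      (by simp)
    rw [abs_mul]
    refine mul_le_mul ((abs_prod_le_pow_card _ h).trans ?_) (h' l) (abs_nonneg _) (by positivity)
    rw [Finset.card_erase_of_mem hl]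
    simp
  · rw [abs_mul]
    refine mul_le_mul ((abs_prod_le_pow_card _ h).trans ?_) (h'' i) (abs_nonneg _) (by positivity)
    simp

lemma continuous_prodDeriv {X : Type*} [TopologicalSpace X] {f f' : X → ι → ℝ}
    (hf : ∀ i, Continuous fun t => f t i) (hf' : ∀ i, Continuous fun t => f' t i) :
    Continuous fun t => prodDeriv (f t) (f' t) := by
  unfold prodDeriv; fun_prop

lemma continuous_prodDeriv₂ {X : Type*} [TopologicalSpace X] {f f' f'' : X → ι → ℝ}
    (hf : ∀ i, Continuous fun t => f t i) (hf' : ∀ i, Continuous fun t => f' t i)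
    (hf'' : ∀ i, Continuous fun t => f'' t i) :
    Continuous fun t => prodDeriv₂ (f t) (f' t) (f'' t) := by
  unfold prodDeriv₂; fun_prop

end ProductRule

lemma hasDerivAt_setIntegral_of_isCompact {X : Type*} [TopologicalSpace X] [T2Space X]
    [SecondCountableTopology X] [MeasurableSpace X] [OpensMeasurableSpace X]
    {μ : Measure X} [IsFiniteMeasureOnCompacts μ] {K : Set X} (hK : IsCompact K)
    {F F' : ℝ → X → ℝ} (hF : ∀ x, ContinuousOn (F x) K) (hF' : ∀ x, ContinuousOn (F' x) K)
    (hd : ∀ x, 0 < x → ∀ t ∈ K, HasDerivAt (fun y => F y t) (F' x t) x)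
    (hb : ∀ d, 0 < d → ∃ B, ∀ x, d ≤ x → ∀ t ∈ K, |F' x t| ≤ B) {x : ℝ} (hx : 0 < x) :
    HasDerivAt (fun y => ∫ t in K, F y t ∂μ) (∫ t in K, F' x t ∂μ) x := by
  obtain ⟨B, hB⟩ := hb (x / 2) (by positivity)
  have hm := hK.measurableSet
  have : IsFiniteMeasure (μ.restrict K) := ⟨by simpa using hK.measure_lt_top⟩
  refine (hasDerivAt_integral_of_dominated_loc_of_deriv_le (s := Ioi (x / 2))
    (bound := fun _ => B) (Ioi_mem_nhds (by linarith))
    (Filter.Eventually.of_forall fun y => (hF y).aestronglyMeasurable hm)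
    ((hF x).integrableOn_compact hK) ((hF' x).aestronglyMeasurable hm) ?_
    (integrable_const B) ?_).2
  · filter_upwards [ae_restrict_mem hm] with t ht y hy using hB y (le_of_lt hy) t ht
  · filter_upwards [ae_restrict_mem hm] with t ht y hy
    exact hd y (lt_trans (by positivity) hy) t ht

/-- The increments `t_{j+1} - t_j` of the extended sequence. -/
def extGap (L : ℝ) {k : ℕ} (t : Fin k → ℝ) (j : Fin (k + 1)) : ℝ :=
  extSeq L t j.succ - extSeq L t j.castSucc

lemma continuous_extSeq_apply (L : ℝ) {k : ℕ} (j : Fin (k + 2)) :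
    Continuous fun t : Fin k → ℝ => extSeq L t j := by
  unfold extSeq
  induction j using Fin.lastCases with
  | last => simpa using continuous_const
  | cast j =>
    simp only [Fin.snoc_castSucc]
    induction j using Fin.cases with
    | zero => simpa using continuous_const
    | succ j => simpa using continuous_apply j

lemma continuous_extGap (L : ℝ) {k : ℕ} (j : Fin (k + 1)) :
    Continuous fun t : Fin k → ℝ => extGap L t j :=
  (continuous_extSeq_apply L _).sub (continuous_extSeq_apply L _)

lemma extSeq_mem_Icc {L : ℝ} (hL : 0 ≤ L) {k : ℕ} {t : Fin k → ℝ} (ht : t ∈ simplexSet L k)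
    (j : Fin (k + 2)) : extSeq L t j ∈ Icc 0 L := by
  unfold extSeq
  induction j using Fin.lastCases with
  | last => simpa using hL
  | cast j =>
    simp only [Fin.snoc_castSucc]
    induction j using Fin.cases with
    | zero => simpa using hL
    | succ j => simpa using ht.2 j

lemma abs_extGap_le {L : ℝ} (hL : 0 ≤ L) {k : ℕ} {t : Fin k → ℝ} (ht : t ∈ simplexSet L k)
    (j : Fin (k + 1)) : |extGap L t j| ≤ L := by
  have h1 := extSeq_mem_Icc hL ht j.succ
  have h2 := extSeq_mem_Icc hL ht j.castSucc
  rw [extGap, abs_le]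
  constructor <;> linarith [h1.1, h1.2, h2.1, h2.2]

section Integrands

variable (L : ℝ) (W : ℝ → ℝ) (k : ℕ)

/-- The integrand of `Sfun`. -/
noncomputable def integrand (x : ℝ) (t : Fin k → ℝ) : ℝ :=
  (∏ j, sincSqrt x (extGap L t j)) * ∏ j, W (t j)

/-- The first derivative of the integrand of `Sfun`. -/
noncomputable def integrandDeriv (x : ℝ) (t : Fin k → ℝ) : ℝ :=
  prodDeriv (fun j => sincSqrt x (extGap L t j)) (fun j => sincSqrtDeriv x (extGap L t j))
    * ∏ j, W (t j)

/-- The second derivative of the integrand of `Sfun`. -/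
noncomputable def integrandDeriv₂ (x : ℝ) (t : Fin k → ℝ) : ℝ :=
  prodDeriv₂ (fun j => sincSqrt x (extGap L t j)) (fun j => sincSqrtDeriv x (extGap L t j))
    (fun j => sincSqrtDeriv₂ x (extGap L t j)) * ∏ j, W (t j)

lemma Sfun_eq_integral_integrand {x : ℝ} (hx : 0 < x) :
    Sfun L W k x = ∫ t in simplexSet L k, integrand L W k x t := by
  unfold Sfun integrand
  congr 1
  ext t
  congr 1
  have h : x ^ (-((k:ℝ) + 1) / 2) = ((√x) ^ (k + 1))⁻¹ := by
    rw [Real.sqrt_eq_rpow, ← Real.rpow_natCast, ← Real.rpow_mul hx.le, ← Real.rpow_neg hx.le]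
    congr 1
    push_cast
    ring
  simp only [sincSqrt, extGap, Finset.prod_div_distrib, Finset.prod_const, Finset.card_univ,
    Fintype.card_fin]
  rw [h]
  ring

variable {L W k}

lemma continuousOn_prod_simplexSet (hW : ContinuousOn W (Icc 0 L)) :
    ContinuousOn (fun t : Fin k → ℝ => ∏ j, W (t j)) (simplexSet L k) :=
  continuousOn_finsetProd _ fun j _ =>
    hW.comp (continuous_apply j).continuousOn fun _ ht => ht.2 j

lemma continuousOn_integrand (hW : ContinuousOn W (Icc 0 L)) (x : ℝ) :
    ContinuousOn (integrand L W k x) (simplexSet L k) :=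
  (continuous_finsetProd _ fun j _ =>
    (continuous_sincSqrt x).comp (continuous_extGap L j)).continuousOn.mul
      (continuousOn_prod_simplexSet hW)

lemma continuousOn_integrandDeriv (hW : ContinuousOn W (Icc 0 L)) (x : ℝ) :
    ContinuousOn (integrandDeriv L W k x) (simplexSet L k) :=
  (continuous_prodDeriv (fun j => (continuous_sincSqrt x).comp (continuous_extGap L j))
    (fun j => (continuous_sincSqrtDeriv x).comp (continuous_extGap L j))).continuousOn.mul
      (continuousOn_prod_simplexSet hW)

lemma continuousOn_integrandDeriv₂ (hW : ContinuousOn W (Icc 0 L)) (x : ℝ) :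
    ContinuousOn (integrandDeriv₂ L W k x) (simplexSet L k) :=
  (continuous_prodDeriv₂ (fun j => (continuous_sincSqrt x).comp (continuous_extGap L j))
    (fun j => (continuous_sincSqrtDeriv x).comp (continuous_extGap L j))
    (fun j => (continuous_sincSqrtDeriv₂ x).comp (continuous_extGap L j))).continuousOn.mul
      (continuousOn_prod_simplexSet hW)

lemma hasDerivAt_integrand {x : ℝ} (hx : 0 < x) (t : Fin k → ℝ) :
    HasDerivAt (fun y => integrand L W k y t) (integrandDeriv L W k x t) x :=
  (hasDerivAt_prod_prodDeriv (f := fun y j => sincSqrt y (extGap L t j))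
    (f' := fun y j => sincSqrtDeriv y (extGap L t j))
    fun _ => hasDerivAt_sincSqrt hx _).mul_const _

lemma hasDerivAt_integrandDeriv {x : ℝ} (hx : 0 < x) (t : Fin k → ℝ) :
    HasDerivAt (fun y => integrandDeriv L W k y t) (integrandDeriv₂ L W k x t) x :=
  (hasDerivAt_prodDeriv (f := fun y j => sincSqrt y (extGap L t j))
    (f' := fun y j => sincSqrtDeriv y (extGap L t j))
    (f'' := fun y j => sincSqrtDeriv₂ y (extGap L t j))
    (fun _ => hasDerivAt_sincSqrt hx _) fun _ => hasDerivAt_sincSqrtDeriv hx _).mul_const _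

lemma abs_prod_simplexSet_le {M : ℝ} (hM : ∀ x ∈ Icc (0:ℝ) L, |W x| ≤ M) {t : Fin k → ℝ}
    (ht : t ∈ simplexSet L k) : |∏ j, W (t j)| ≤ M ^ k :=
  (abs_prod_le_pow_card _ fun j => hM _ (ht.2 j)).trans (by simp)

lemma exists_abs_integrandDeriv_le (hL : 0 ≤ L) {d : ℝ} (hd : 0 < d) :
    ∃ C : ℝ, 0 < C ∧ ∀ (W : ℝ → ℝ) (M : ℝ), (∀ x ∈ Icc (0:ℝ) L, |W x| ≤ M) →
      ∀ k : ℕ, 1 ≤ k → ∀ x, d ≤ x → ∀ t ∈ simplexSet L k,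
        |integrandDeriv L W k x t| ≤ C * ((k:ℝ) + 1) * M ^ k * (√x)⁻¹ ^ (k + 2) ∧
        |integrandDeriv₂ L W k x t| ≤ C * ((k:ℝ) + 1) ^ 2 * M ^ k * (√x)⁻¹ ^ (k + 3) := by
  have hrd : 0 < √d := Real.sqrt_pos.2 hd
  obtain ⟨c₁, hc₁, h₁⟩ : ∃ c : ℝ, 0 < c ∧ ∀ x a, d ≤ x → |a| ≤ L →
      |sincSqrtDeriv x a| ≤ c * (√x)⁻¹ ^ 2 :=
    ⟨_, by positivity, fun _ _ hx ha => abs_sincSqrtDeriv_le hd hx ha⟩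
  obtain ⟨c₂, hc₂, h₂⟩ : ∃ c : ℝ, 0 < c ∧ ∀ x a, d ≤ x → |a| ≤ L →
      |sincSqrtDeriv₂ x a| ≤ c * (√x)⁻¹ ^ 3 :=
    ⟨_, by positivity, fun _ _ hx ha => abs_sincSqrtDeriv₂_le hd hx ha⟩
  refine ⟨c₁ + c₁ ^ 2 + c₂, by positivity, fun W M hM k hk x hx t ht => ?_⟩
  have hM0 : 0 ≤ M := (abs_nonneg _).trans (hM 0 ⟨le_rfl, hL⟩)
  have hu : 0 ≤ (√x)⁻¹ := by positivity
  have hP := abs_prod_simplexSet_le hM ht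
  have b0 := fun j => abs_sincSqrt_le x (extGap L t j)
  have b1 := fun j => h₁ x _ hx (abs_extGap_le hL ht j)
  have b2 := fun j => h₂ x _ hx (abs_extGap_le hL ht j)
  have e1 := abs_prodDeriv_le hu b0 b1
  have e2 := abs_prodDeriv₂_le hu b0 b1 b2
  obtain ⟨m, rfl⟩ : ∃ m, k = m + 1 := ⟨k - 1, by omega⟩
  simp only [Fintype.card_fin, Nat.add_sub_cancel] at e1 e2
  generalize (√x)⁻¹ = u at *
  unfold integrandDeriv integrandDeriv₂
  rw [abs_mul, abs_mul]
  constructor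
  · refine (mul_le_mul e1 hP (abs_nonneg _) (by positivity)).trans ?_
    calc _ = c₁ * ((m + 1 : ℕ) + 1) * M ^ (m + 1) * u ^ (m + 1 + 2) := by push_cast; ring
      _ ≤ _ := by gcongr; nlinarith
  · refine (mul_le_mul e2 hP (abs_nonneg _) (by positivity)).trans ?_
    calc _ = (c₁ ^ 2 * (m + 1) + c₂) * (m + 2) * M ^ (m + 1) * u ^ (m + 1 + 3) := by
          push_cast; ring
      _ ≤ ((c₁ + c₁ ^ 2 + c₂) * (m + 2)) * (m + 2) * M ^ (m + 1) * u ^ (m + 1 + 3) := by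
          gcongr
          have : (0:ℝ) ≤ m := m.cast_nonneg
          nlinarith [mul_nonneg hc₁.le this, mul_nonneg hc₂.le this, sq_nonneg c₁]
      _ = _ := by push_cast; ring

lemma hasDerivAt_Sfun (hL : 0 ≤ L) (hW : ContinuousOn W (Icc 0 L)) {M : ℝ}
    (hM : ∀ x ∈ Icc (0:ℝ) L, |W x| ≤ M) (hk : 1 ≤ k) {x : ℝ} (hx : 0 < x) :
    HasDerivAt (Sfun L W k) (∫ t in simplexSet L k, integrandDeriv L W k x t) x := by
  refine (hasDerivAt_setIntegral_of_isCompact (isCompact_simplexSet L k)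
    (continuousOn_integrand hW) (continuousOn_integrandDeriv hW)
    (fun y hy t _ => hasDerivAt_integrand hy t) (fun d hd => ?_) hx).congr_of_eventuallyEq ?_
  · obtain ⟨C, hC, h⟩ := exists_abs_integrandDeriv_le hL hd
    have hM0 : 0 ≤ M := (abs_nonneg _).trans (hM 0 ⟨le_rfl, hL⟩)
    have hrd : 0 < √d := Real.sqrt_pos.2 hd
    refine ⟨C * ((k:ℝ) + 1) * M ^ k * (√d)⁻¹ ^ (k + 2), fun y hy t ht =>
      (h W M hM k hk y hy t ht).1.trans ?_⟩
    gcongr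
  · filter_upwards [Ioi_mem_nhds hx] with y hy using Sfun_eq_integral_integrand L W k hy

lemma hasDerivAt_deriv_Sfun (hL : 0 ≤ L) (hW : ContinuousOn W (Icc 0 L)) {M : ℝ}
    (hM : ∀ x ∈ Icc (0:ℝ) L, |W x| ≤ M) (hk : 1 ≤ k) {x : ℝ} (hx : 0 < x) :
    HasDerivAt (deriv (Sfun L W k)) (∫ t in simplexSet L k, integrandDeriv₂ L W k x t) x := by
  refine (hasDerivAt_setIntegral_of_isCompact (isCompact_simplexSet L k)
    (continuousOn_integrandDeriv hW) (continuousOn_integrandDeriv₂ hW)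
    (fun y hy t _ => hasDerivAt_integrandDeriv hy t) (fun d hd => ?_) hx).congr_of_eventuallyEq ?_
  · obtain ⟨C, hC, h⟩ := exists_abs_integrandDeriv_le hL hd
    have hM0 : 0 ≤ M := (abs_nonneg _).trans (hM 0 ⟨le_rfl, hL⟩)
    have hrd : 0 < √d := Real.sqrt_pos.2 hd
    refine ⟨C * ((k:ℝ) + 1) ^ 2 * M ^ k * (√d)⁻¹ ^ (k + 3), fun y hy t ht =>
      (h W M hM k hk y hy t ht).2.trans ?_⟩
    gcongr
  · filter_upwards [Ioi_mem_nhds hx] with y hy using (hasDerivAt_Sfun hL hW hM hk hy).deriv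

lemma abs_integral_simplexSet_le (hL : 0 ≤ L) {f : (Fin k → ℝ) → ℝ} {B x : ℝ} {n : ℕ}
    (hx : 0 ≤ x) (hB : 0 ≤ B) (hf : ∀ t ∈ simplexSet L k, |f t| ≤ B * (√x)⁻¹ ^ n) :
    |∫ t in simplexSet L k, f t| ≤ B * L ^ k / (k.factorial * x ^ ((n:ℝ) / 2)) := by
  refine (norm_setIntegral_le_of_norm_le_const (f := f)
    (isCompact_simplexSet L k).measure_lt_top hf).trans ?_
  have h : x ^ ((n:ℝ) / 2) = (√x) ^ n := by
    rw [Real.sqrt_eq_rpow, ← Real.rpow_natCast, ← Real.rpow_mul hx]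
    congr 1
    ring
  rw [h]
  calc B * (√x)⁻¹ ^ n * volume.real (simplexSet L k)
      ≤ B * (√x)⁻¹ ^ n * (L ^ k / k.factorial) := by
        gcongr; exact measureReal_simplexSet_le hL k
    _ = _ := by rw [inv_pow, div_eq_mul_inv, div_eq_mul_inv, mul_inv]; ring

end Integrands

/-- Each `S_k` is twice differentiable on `(0,∞)`, and for a constant `C = C(L)`,
`|S_k'(λ)| ≤ C(k+1)‖W‖^k L^k/(k! λ^{(k+2)/2})` and
`|S_k''(λ)| ≤ C(k+1)²‖W‖^k L^k/(k! λ^{(k+3)/2})` for all `λ ≥ 1`. -/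
theorem Sfun_deriv_bounds (L : ℝ) (hL : 0 < L) :
    ∃ C : ℝ, 0 < C ∧ ∀ (W : ℝ → ℝ), ContinuousOn W (Icc 0 L) →
      ∀ M : ℝ, (∀ x ∈ Icc (0:ℝ) L, |W x| ≤ M) →
      ∀ k : ℕ, 1 ≤ k →
        (∀ lam : ℝ, 0 < lam →
          DifferentiableAt ℝ (Sfun L W k) lam ∧
          DifferentiableAt ℝ (deriv (Sfun L W k)) lam) ∧
        (∀ lam : ℝ, 1 ≤ lam →
          |deriv (Sfun L W k) lam| ≤
            C * ((k:ℝ)+1) * M^k * L^k / (Nat.factorial k * lam ^ (((k:ℝ)+2)/2)) ∧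
          |deriv (deriv (Sfun L W k)) lam| ≤
            C * ((k:ℝ)+1)^2 * M^k * L^k / (Nat.factorial k * lam ^ (((k:ℝ)+3)/2))) := by
  obtain ⟨C, hC, h⟩ := exists_abs_integrandDeriv_le hL.le one_pos
  refine ⟨C, hC, fun W hW M hM k hk => ⟨fun x hx =>
    ⟨(hasDerivAt_Sfun hL.le hW hM hk hx).differentiableAt,
      (hasDerivAt_deriv_Sfun hL.le hW hM hk hx).differentiableAt⟩, fun x hx => ?_⟩⟩
  have hM0 : 0 ≤ M := (abs_nonneg _).trans (hM 0 ⟨le_rfl, hL.le⟩)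
  have hx0 : 0 < x := one_pos.trans_le hx
  rw [(hasDerivAt_Sfun hL.le hW hM hk hx0).deriv,
    (hasDerivAt_deriv_Sfun hL.le hW hM hk hx0).deriv]
  constructor
  · have := abs_integral_simplexSet_le hL.le hx0.le (by positivity)
      fun t ht => (h W M hM k hk x hx t ht).1
    exact_mod_cast this
  · have := abs_integral_simplexSet_le hL.le hx0.le (by positivity)
      fun t ht => (h W M hM k hk x hx t ht).2
    exact_mod_cast this
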